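/- Let J be a monotone NAE21SAT instance over a linearly ordered finite variable set X: a finite set of clauses, each clause a strictly increasing 21-tuple (y₁,…,y₂₁) of elements of X. Suppose J is 6-robustly NAE-satisfiable: every partial function from at most 6 elements of X to Bool extends to an assignment NAE-satisfying J. Let f(J) be the chain-reduced NAE3SAT instance defined below. Then: (1) every partial function from at most 2 variables of f(J) to Bool extends to an assignment NAE-satisfying f(J); (2) if ℓ and ℓ' are literals appearing in distinct clauses c and d of f(J), then every consistent assignment of Boolean values to ℓ and ℓ' (if ℓ' is the negation of ℓ they receive opposite values; if ℓ' = ℓ the same value) extends to an assignment NAE-satisfying f(J) under which ℓ takes a majority value in c; (3) if z is a Z-variable of f(J), with z occurring positively in clause c and ¬z occurring in clause d, then there exist X-variables x in c and y in d and an assignment p NAE-satisfying f(J) with p(x) = p(z) and p(y) = ¬p(z); (4) for each clause of f(J), every assignment of Boolean values to the three literals of that clause under which the three literal values are not all equal extends to an assignment NAE-satisfying f(J). -/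

import Mathlib

/-- The variables of the chain-reduced instance `f(J)`: the original variables `X`
(`Sum.inl`), together with a `Z`-variable `z_{C,t+2}` for each (potential) clause
`C : Fin 21 → X` and each `t : Fin 18` (so `t = 0, …, 17` codes the indices `2, …, 19`). -/
abbrev FVar (X : Type) := X ⊕ ((Fin 21 → X) × Fin 18)

/-- A literal: a variable together with a sign (`true` = positive). -/
abbrev FLit (X : Type) := FVar X × Bool

/-- A ternary clause: an ordered triple of literals. -/
abbrev FCl (X : Type) := FLit X × FLit X × FLit X

/-- The value of a literal under an assignment. -/
def litVal {X : Type} (μ : FVar X → Bool) (l : FLit X) : Bool :=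
  if l.2 then μ l.1 else !(μ l.1)

/-- The clauses of the chain-reduced instance `f(J)` of a monotone NAE21SAT instance `J`:
for each clause `C = (y₁, …, y₂₁)` of `J`, the triples `(y₁, y₂, z_{C,2})`;
`(¬z_{C,t}, y_{t+1}, z_{C,t+1})` for `t = 2, …, 18`; and `(¬z_{C,19}, y₂₀, y₂₁)`. -/
def fClauses {X : Type} (J : Finset (Fin 21 → X)) : Set (FCl X) :=
  { c | ∃ C ∈ J,
      c = ((Sum.inl (C 0), true), (Sum.inl (C 1), true),
            (Sum.inr (C, (0 : Fin 18)), true)) ∨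
      (∃ s : Fin 17,
        c = ((Sum.inr (C, s.castSucc), false),
              (Sum.inl (C ⟨s.1 + 2, by have := s.isLt; omega⟩), true),
              (Sum.inr (C, s.succ), true))) ∨
      c = ((Sum.inr (C, (17 : Fin 18)), false), (Sum.inl (C 19), true),
            (Sum.inl (C 20), true)) }

/-- An assignment NAE-satisfies `f(J)` if on every clause of `f(J)` the three literal
values are not all equal. -/
def fSat {X : Type} (J : Finset (Fin 21 → X)) (μ : FVar X → Bool) : Prop :=
  ∀ c ∈ fClauses J, ¬(litVal μ c.1 = litVal μ c.2.1 ∧ litVal μ c.2.1 = litVal μ c.2.2)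

/-- The variables of the instance `f(J)`: all `X`-variables, and the `Z`-variables of the
clauses of `J`. -/
def inVar {X : Type} (J : Finset (Fin 21 → X)) : FVar X → Prop
  | Sum.inl _ => True
  | Sum.inr (C, _) => C ∈ J

/-- A literal appears in a ternary clause. -/
def litIn {X : Type} (l : FLit X) (c : FCl X) : Prop :=
  l = c.1 ∨ l = c.2.1 ∨ l = c.2.2

/-- A variable appears (with some sign) in a ternary clause. -/
def varIn {X : Type} (v : FVar X) (c : FCl X) : Prop :=
  v = c.1.1 ∨ v = c.2.1.1 ∨ v = c.2.2.1

/-- The literal `l` takes a majority value in the clause `c` under `μ`: its value equals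
the value of at least two of the three literals of `c`. -/
def majorityIn {X : Type} (μ : FVar X → Bool) (l : FLit X) (c : FCl X) : Prop :=
  2 ≤ (if litVal μ c.1 = litVal μ l then 1 else 0) +
      (if litVal μ c.2.1 = litVal μ l then 1 else 0) +
      (if litVal μ c.2.2 = litVal μ l then 1 else 0)

/-- `J` is 6-robustly NAE-satisfiable: every partial assignment defined on at most `6`
variables extends to an assignment that is not constant on any clause of `J`. -/
def robust6 {X : Type} (J : Finset (Fin 21 → X)) : Prop :=
  ∀ D : Finset X, D.card ≤ 6 → ∀ p : X → Bool,
    ∃ ν : X → Bool, (∀ x ∈ D, ν x = p x) ∧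
      ∀ C ∈ J, ∃ i j : Fin 21, ν (C i) ≠ ν (C j)


namespace NaeChain

/-- `z` NAE-satisfies the chain of ternary clauses built over the values `y`. -/
def IsChain (y z : ℕ → Bool) : Prop :=
  ¬(y 0 = y 1 ∧ y 1 = z 0) ∧
  (∀ s < 17, ¬((!z s) = y (s + 2) ∧ y (s + 2) = z (s + 1))) ∧
  ¬((!z 17) = y 19 ∧ y 19 = y 20)

/-- A chain equal to `a` from `p - 1` to `r` and to `b` from `r + 1` to `q - 2`. -/
theorem exists_isChain (y : ℕ → Bool) (a b : Bool) (p r q : ℕ) (hp : y p = !a) (hq : y q = b)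
    (hpr : p ≤ r + 1) (hrq : r + 2 ≤ q) (hq20 : q ≤ 20) (hr : r ≤ 17)
    (hab : a ≠ b → r + 3 ≤ q ∧ y (r + 2) = a) :
    ∃ z, IsChain y z ∧ (∀ i, p ≤ i + 1 → i ≤ r → z i = a) ∧
      (∀ i, r < i → i + 2 ≤ q → z i = b) := by
  classical
  obtain ⟨P, hP, hPp, hPmin⟩ : ∃ P, y P = (!a) ∧ P ≤ p ∧ ∀ i < P, y i = a := by
    have h : ∃ i, y i = !a := ⟨p, hp⟩
    refine ⟨Nat.find h, Nat.find_spec h, Nat.find_min' h hp, fun i hi => ?_⟩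
    have := Nat.find_min h hi
    simpa using this
  obtain ⟨Q, hQ, hQ20, hQq, hQmax⟩ :
      ∃ Q, y Q = b ∧ Q ≤ 20 ∧ q ≤ Q ∧ ∀ i ≤ 20, Q < i → y i = !b := by
    have h : ∃ i, y (20 - i) = b := ⟨20 - q, by rwa [Nat.sub_sub_self hq20]⟩
    have hle : Nat.find h ≤ 20 - q := Nat.find_min' h (by rwa [Nat.sub_sub_self hq20])
    refine ⟨20 - Nat.find h, Nat.find_spec h, by omega, by omega, fun i hi hlt => ?_⟩
    have := Nat.find_min h (m := 20 - i) (by omega)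
    rw [Nat.sub_sub_self hi] at this
    cases b <;> simpa using this
  refine ⟨fun i => if i ≤ r then (if i + 1 < P then !a else a)
    else (if i + 2 ≤ Q then b else !b), ⟨?_, ?_, ?_⟩, ?_, ?_⟩
  · have h0 := hPmin 0
    have h1 := hPmin 1
    obtain rfl | rfl | h : P = 0 ∨ P = 1 ∨ 1 < P := by omega
    all_goals grind
  · intro s hs
    cases a <;> cases b <;> grind
  · have h0 := hQmax 19
    have h1 := hQmax 20
    obtain rfl | rfl | h : Q = 20 ∨ Q = 19 ∨ Q < 19 := by omega
    all_goals cases a <;> cases b <;> grind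
  · grind
  · grind

theorem exists_isChain_of_ne (y : ℕ → Bool) (h : ∃ i ≤ 20, ∃ j ≤ 20, y i ≠ y j) :
    ∃ z, IsChain y z := by
  obtain ⟨i, hi, j, hj, hij⟩ := h
  have key : ∀ p r q, y p ≠ y q → p ≤ r + 1 → r + 2 ≤ q → q ≤ 20 → r ≤ 17 →
      ∃ z, IsChain y z := by
    intro p r q hpq h1 h2 h3 h4
    obtain ⟨z, hz, -⟩ := exists_isChain y (y q) (y q) p r q (Bool.eq_not.2 hpq) rfl h1 h2 h3 h4
      (by simp)
    exact ⟨z, hz⟩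
  by_cases h19 : y 0 = y 19
  · by_cases h20 : y 0 = y 20
    · obtain ⟨k, hk, hk0⟩ : ∃ k ≤ 20, y k ≠ y 0 := by
        by_cases hi0 : y i = y 0
        · exact ⟨j, hj, fun hj0 => hij (hi0.trans hj0.symm)⟩
        · exact ⟨i, hi, hi0⟩
      have : k ≠ 19 := by rintro rfl; exact hk0 h19.symm
      have : k ≠ 20 := by rintro rfl; exact hk0 h20.symm
      exact key k (k - 1) 20 (by rwa [← h20]) (by omega) (by omega) le_rfl (by omega)
    · exact key 0 0 20 h20 (by omega) (by omega) (by omega) (by omega)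
  · exact key 0 0 19 h19 (by omega) (by omega) (by omega) (by omega)

variable {X : Type}

/-- The `i`-th variable of the clause `C`, indexed by natural numbers `i ≤ 20`. -/
def entry (C : Fin 21 → X) (i : ℕ) : X := C (Fin.ofNat 21 i)

/-- The `i`-th chain variable of the clause `C`, indexed by natural numbers `i ≤ 17`. -/
def link (C : Fin 21 → X) (i : ℕ) : FVar X := Sum.inr (C, Fin.ofNat 18 i)

theorem entry_inj {C : Fin 21 → X} (hC : Function.Injective C) {i j : ℕ} (hi : i ≤ 20)
    (hj : j ≤ 20) : entry C i = entry C j ↔ i = j := by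
  refine ⟨fun h => ?_, fun h => h ▸ rfl⟩
  have := congrArg Fin.val (hC h)
  simp only [Fin.ofNat] at this
  omega

theorem link_inj {C D : Fin 21 → X} {i j : ℕ} (hi : i ≤ 17) (hj : j ≤ 17) :
    link C i = link D j ↔ C = D ∧ i = j := by
  simp only [link, Sum.inr.injEq, Prod.mk.injEq, Fin.ofNat, Fin.mk.injEq]
  refine and_congr_right fun _ => ?_
  omega

theorem inl_ne_link (x : X) (C : Fin 21 → X) (i : ℕ) : (Sum.inl x : FVar X) ≠ link C i :=
  Sum.inl_ne_inr

theorem mem_fClauses_iff (J : Finset (Fin 21 → X)) (c : FCl X) :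
    c ∈ fClauses J ↔ ∃ C ∈ J,
      c = ((Sum.inl (entry C 0), true), (Sum.inl (entry C 1), true), (link C 0, true)) ∨
      (∃ s < 17, c = ((link C s, false), (Sum.inl (entry C (s + 2)), true),
        (link C (s + 1), true))) ∨
      c = ((link C 17, false), (Sum.inl (entry C 19), true), (Sum.inl (entry C 20), true)) := by
  have hmid (C : Fin 21 → X) (s : Fin 17) :
      (((Sum.inr (C, s.castSucc), false), (Sum.inl (C ⟨s.1 + 2, by omega⟩), true),
        (Sum.inr (C, s.succ), true)) : FCl X) =
      ((link C s, false), (Sum.inl (entry C (s + 2)), true), (link C (s + 1), true)) := by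
    have h1 : s.castSucc = Fin.ofNat 18 s := by ext; simp [Fin.ofNat]; omega
    have h2 : s.succ = Fin.ofNat 18 (s + 1) := by ext; simp [Fin.ofNat]; omega
    have h3 : (⟨s.1 + 2, by omega⟩ : Fin 21) = Fin.ofNat 21 (s + 2) := by
      ext; simp [Fin.ofNat]; omega
    rw [h1, h2, h3]; rfl
  refine exists_congr fun C => and_congr_right fun _ => or_congr Iff.rfl (or_congr ?_ Iff.rfl)
  constructor
  · rintro ⟨s, rfl⟩
    exact ⟨s, s.isLt, hmid C s⟩
  · rintro ⟨s, hs, rfl⟩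
    exact ⟨⟨s, hs⟩, (hmid C ⟨s, hs⟩).symm⟩

theorem fSat_of_isChain {J : Finset (Fin 21 → X)} {μ : FVar X → Bool}
    (h : ∀ C ∈ J, IsChain (fun i => μ (Sum.inl (entry C i))) (fun i => μ (link C i))) :
    fSat J μ := by
  intro c hc
  obtain ⟨C, hC, rfl | ⟨s, hs, rfl⟩ | rfl⟩ := (mem_fClauses_iff J c).1 hc
  · simpa [litVal] using (h C hC).1
  · simpa [litVal] using (h C hC).2.1 s hs
  · simpa [litVal] using (h C hC).2.2

theorem isChain_congr {y z z' : ℕ → Bool} (h : ∀ i ≤ 17, z' i = z i) (hz : IsChain y z) :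
    IsChain y z' := by
  refine ⟨?_, fun s hs => ?_, ?_⟩
  · rw [h 0 (by omega)]; exact hz.1
  · rw [h s (by omega), h (s + 1) (by omega)]; exact hz.2.1 s hs
  · rw [h 17 le_rfl]; exact hz.2.2

/-- No variable is given two different values by the list `L`. -/
def Consistent (L : List (X × Bool)) : Prop := L.Pairwise fun u v => u.1 = v.1 → u.2 = v.2

/-- Assemble an assignment from prescribed values of at most six `X`-variables and
chain requirements that those values make satisfiable. -/
theorem exists_fSat {J : Finset (Fin 21 → X)} (hrob : robust6 J) (L : List (X × Bool))
    (hL : Consistent L) (hlen : L.length ≤ 6) (R : (Fin 21 → X) → (ℕ → Bool) → Prop)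
    (hR : ∀ C ∈ J, ∀ ν : X → Bool, (∀ u ∈ L, ν u.1 = u.2) →
      (∃ z, IsChain (fun i => ν (entry C i)) z) →
      ∃ z, IsChain (fun i => ν (entry C i)) z ∧ R C z) :
    ∃ μ : FVar X → Bool, fSat J μ ∧ (∀ u ∈ L, μ (Sum.inl u.1) = u.2) ∧
      ∀ C ∈ J, ∃ z, R C z ∧ ∀ i ≤ 17, μ (link C i) = z i := by
  classical
  obtain ⟨p, hp⟩ : ∃ p : X → Bool, ∀ u ∈ L, p u.1 = u.2 := by
    clear hlen hR
    unfold Consistent at hL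
    induction L with
    | nil => exact ⟨fun _ => true, by simp⟩
    | cons u L ih =>
      rw [List.pairwise_cons] at hL
      obtain ⟨p, hp⟩ := ih hL.2
      refine ⟨Function.update p u.1 u.2, fun v hv => ?_⟩
      obtain rfl | hv := List.mem_cons.1 hv
      · simp
      · by_cases h : v.1 = u.1
        · rw [h, Function.update_self]; exact hL.1 v hv h.symm
        · rw [Function.update_of_ne h]; exact hp v hv
  obtain ⟨ν, hν, hne⟩ := hrob (L.map Prod.fst).toFinset
    ((List.toFinset_card_le _).trans (by simpa using hlen)) p
  have hνL : ∀ u ∈ L, ν u.1 = u.2 := fun u hu => by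
    rw [hν u.1 (List.mem_toFinset.2 (List.mem_map_of_mem hu)), hp u hu]
  have hz : ∀ C, ∃ z, C ∈ J → IsChain (fun i => ν (entry C i)) z ∧ R C z := by
    intro C
    by_cases hC : C ∈ J
    · obtain ⟨z, hz⟩ := hR C hC ν hνL (exists_isChain_of_ne _ (by
        obtain ⟨i, j, hij⟩ := hne C hC
        exact ⟨i, by omega, j, by omega, by simpa [entry] using hij⟩))
      exact ⟨z, fun _ => hz⟩
    · exact ⟨fun _ => true, fun h => absurd h hC⟩
  choose z hz using hz
  have hlink : ∀ C, ∀ i ≤ 17, (Sum.elim ν fun w => z w.1 w.2 : FVar X → Bool) (link C i) =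
      z C i := by
    intro C i hi
    simp only [link, Sum.elim_inr, Fin.ofNat]
    rw [Nat.mod_eq_of_lt (by omega)]
  refine ⟨Sum.elim ν fun w => z w.1 w.2, fSat_of_isChain fun C hC =>
    isChain_congr (hlink C) (hz C hC).1, by simpa using hνL, fun C hC =>
    ⟨z C, (hz C hC).2, hlink C⟩⟩

theorem exists_fSat_of_consistent {J : Finset (Fin 21 → X)} (hrob : robust6 J)
    (L : List (X × Bool)) (hL : Consistent L) (hlen : L.length ≤ 6) :
    ∃ μ : FVar X → Bool, fSat J μ ∧ ∀ u ∈ L, μ (Sum.inl u.1) = u.2 := by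
  obtain ⟨μ, h, h', -⟩ := exists_fSat hrob L hL hlen (fun _ _ => True)
    fun C _ ν _ hz => by simpa using hz
  exact ⟨μ, h, h'⟩

theorem exists_fSat_of_link {J : Finset (Fin 21 → X)} (hrob : robust6 J)
    (L : List (X × Bool)) (hL : Consistent L) (hlen : L.length ≤ 6)
    {C : Fin 21 → X} (hC : C ∈ J) (a b : Bool) (p r q : ℕ)
    (hp : (entry C p, !a) ∈ L) (hq : (entry C q, b) ∈ L)
    (hpr : p ≤ r + 1) (hrq : r + 2 ≤ q) (hq20 : q ≤ 20) (hr : r ≤ 17)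
    (hab : a ≠ b → r + 3 ≤ q ∧ (entry C (r + 2), a) ∈ L) :
    ∃ μ : FVar X → Bool, fSat J μ ∧ (∀ u ∈ L, μ (Sum.inl u.1) = u.2) ∧
      (∀ i, p ≤ i + 1 → i ≤ r → μ (link C i) = a) ∧
      (∀ i, r < i → i + 2 ≤ q → i ≤ 17 → μ (link C i) = b) := by
  obtain ⟨μ, h, h', hz⟩ := exists_fSat hrob L hL hlen (fun D z => D = C →
      (∀ i, p ≤ i + 1 → i ≤ r → z i = a) ∧ (∀ i, r < i → i + 2 ≤ q → z i = b))
    fun D _ ν hν hz => by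
      by_cases hD : D = C
      · subst hD
        obtain ⟨z, hz⟩ := exists_isChain (fun i => ν (entry D i)) a b p r q (hν _ hp) (hν _ hq)
          hpr hrq hq20 hr fun h => ⟨(hab h).1, hν _ (hab h).2⟩
        exact ⟨z, hz.1, fun _ => hz.2⟩
      · exact hz.imp fun z hz => ⟨hz, fun h => absurd h hD⟩
  obtain ⟨w, hw, hμ⟩ := hz C hC
  obtain ⟨h1, h2⟩ := hw rfl
  refine ⟨μ, h, h', fun i hi hi' => ?_, fun i hi hi' hi'' => ?_⟩
  · rw [hμ i (by omega), h1 i hi hi']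
  · rw [hμ i (by omega), h2 i hi hi']

theorem exists_fSat_of_const_link {J : Finset (Fin 21 → X)} (hrob : robust6 J)
    (L : List (X × Bool)) (hL : Consistent L) (hlen : L.length ≤ 6)
    {C : Fin 21 → X} (hC : C ∈ J) (a : Bool) (p q : ℕ)
    (hp : (entry C p, !a) ∈ L) (hq : (entry C q, a) ∈ L)
    (hp1 : p ≤ 1) (hq19 : 19 ≤ q) (hq20 : q ≤ 20) :
    ∃ μ : FVar X → Bool, fSat J μ ∧ (∀ u ∈ L, μ (Sum.inl u.1) = u.2) ∧
      ∀ i ≤ 17, μ (link C i) = a := by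
  obtain ⟨μ, h, h', h1, -⟩ := exists_fSat_of_link hrob L hL hlen hC a a p 17 q hp hq
    (by omega) (by omega) hq20 le_rfl (by simp)
  exact ⟨μ, h, h', fun i hi => h1 i (by omega) hi⟩

theorem exists_fSat_of_const_link₂ {J : Finset (Fin 21 → X)} (hrob : robust6 J)
    (L : List (X × Bool)) (hL : Consistent L) (hlen : L.length ≤ 6)
    {C D : Fin 21 → X} (hC : C ∈ J) (hD : D ∈ J) (hCD : C ≠ D) (a b : Bool) (p q p' q' : ℕ)
    (hp : (entry C p, !a) ∈ L) (hq : (entry C q, a) ∈ L)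
    (hp' : (entry D p', !b) ∈ L) (hq' : (entry D q', b) ∈ L)
    (hp1 : p ≤ 1) (hq19 : 19 ≤ q) (hq20 : q ≤ 20)
    (hp1' : p' ≤ 1) (hq19' : 19 ≤ q') (hq20' : q' ≤ 20) :
    ∃ μ : FVar X → Bool, fSat J μ ∧ (∀ u ∈ L, μ (Sum.inl u.1) = u.2) ∧
      (∀ i ≤ 17, μ (link C i) = a) ∧ ∀ i ≤ 17, μ (link D i) = b := by
  obtain ⟨μ, h, h', hz⟩ := exists_fSat hrob L hL hlen
    (fun E z => (E = C → ∀ i ≤ 17, z i = a) ∧ (E = D → ∀ i ≤ 17, z i = b))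
    fun E _ ν hν hz => by
      by_cases hEC : E = C
      · subst hEC
        obtain ⟨z, hz, h1, -⟩ := exists_isChain (fun i => ν (entry E i)) a a p 17 q (hν _ hp)
          (hν _ hq) (by omega) (by omega) hq20 le_rfl (by simp)
        exact ⟨z, hz, fun _ i hi => h1 i (by omega) hi, fun h => absurd h hCD⟩
      by_cases hED : E = D
      · subst hED
        obtain ⟨z, hz, h1, -⟩ := exists_isChain (fun i => ν (entry E i)) b b p' 17 q' (hν _ hp')
          (hν _ hq') (by omega) (by omega) hq20' le_rfl (by simp)
        exact ⟨z, hz, fun h => absurd h hEC, fun _ i hi => h1 i (by omega) hi⟩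
      · exact hz.imp fun z hz => ⟨hz, fun h => absurd h hEC, fun h => absurd h hED⟩
  obtain ⟨w, hw, hμ⟩ := hz C hC
  obtain ⟨z', hz', hμ'⟩ := hz D hD
  refine ⟨μ, h, h', fun i hi => ?_, fun i hi => ?_⟩
  · rw [hμ i hi, hw.1 rfl i hi]
  · rw [hμ' i hi, hz'.2 rfl i hi]

theorem inVar_cases {J : Finset (Fin 21 → X)} {w : FVar X} (hw : inVar J w) :
    (∃ x, w = Sum.inl x) ∨ ∃ D ∈ J, ∃ t ≤ 17, w = link D t := by
  rcases w with x | ⟨D, t⟩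
  · exact Or.inl ⟨x, rfl⟩
  · exact Or.inr ⟨D, hw, t, by omega, by simp [link]⟩

theorem exists_entry_ne {C : Fin 21 → X} (hC : Function.Injective C) (x : X) {i j : ℕ}
    (hi : i ≤ 20) (hj : j ≤ 20) (hij : i ≠ j) : ∃ k, (k = i ∨ k = j) ∧ entry C k ≠ x := by
  by_cases h : entry C i = x
  · exact ⟨j, Or.inr rfl, fun h' => hij ((entry_inj hC hi hj).1 (h.trans h'.symm))⟩
  · exact ⟨i, Or.inl rfl, h⟩

/-- The chain variables of `C` are given the common value `a`, a middle variable of `C` is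
given an arbitrary value, and one further variable is prescribed. -/
theorem exists_fSat_const_middle {J : Finset (Fin 21 → X)}
    (hinj : ∀ C ∈ J, Function.Injective C) (hrob : robust6 J) {C : Fin 21 → X} (hC : C ∈ J)
    {k : ℕ} (hk : 2 ≤ k) (hk' : k ≤ 18) (e a b : Bool)
    {w : FVar X} (hw : inVar J w) (hx : w = Sum.inl (entry C k) → b = e)
    (hz : ∀ i ≤ 17, w = link C i → b = a) :
    ∃ μ : FVar X → Bool, fSat J μ ∧ μ (Sum.inl (entry C k)) = e ∧
      (∀ i ≤ 17, μ (link C i) = a) ∧ μ w = b := by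
  have hCi : ∀ i j, i ≤ 20 → j ≤ 20 → entry C i = entry C j → i = j :=
    fun i j hi hj => (entry_inj (hinj C hC) hi hj).1
  obtain ⟨x, rfl⟩ | ⟨D, hD, t, ht, rfl⟩ := inVar_cases hw
  · obtain ⟨p, hp, hpx⟩ := exists_entry_ne (hinj C hC) x (i := 0) (j := 1) (by omega) (by omega)
      (by omega)
    obtain ⟨q, hq, hqx⟩ := exists_entry_ne (hinj C hC) x (i := 19) (j := 20) (by omega)
      (by omega) (by omega)
    obtain ⟨μ, h1, h2, h3⟩ := exists_fSat_of_const_link hrob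
      [(entry C k, e), (entry C p, !a), (entry C q, a), (x, b)]
      (by simp [Consistent]; grind) (by simp) hC a p q (by simp) (by simp) (by omega) (by omega)
      (by omega)
    simp at h2
    grind
  · by_cases hCD : C = D
    · subst hCD
      obtain ⟨μ, h1, h2, h3⟩ := exists_fSat_of_const_link hrob
        [(entry C k, e), (entry C 0, !a), (entry C 20, a)]
        (by simp [Consistent]; grind) (by simp) hC a 0 20 (by simp) (by simp) (by omega)
        (by omega) (by omega)
      simp at h2
      grind
    · have hDi : ∀ i j, i ≤ 20 → j ≤ 20 → entry D i = entry D j → i = j :=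
        fun i j hi hj => (entry_inj (hinj D hD) hi hj).1
      obtain ⟨p', hp', hpx'⟩ := exists_entry_ne (hinj D hD) (entry C k) (i := 0) (j := 1)
        (by omega) (by omega) (by omega)
      obtain ⟨q', hq', hqx'⟩ := exists_entry_ne (hinj D hD) (entry C k) (i := 19) (j := 20)
        (by omega) (by omega) (by omega)
      obtain ⟨p, hp, hpx⟩ := exists_entry_ne (hinj C hC) (entry D (if a = b then q' else p'))
        (i := 0) (j := 1) (by omega) (by omega) (by omega)
      obtain ⟨q, hq, hqx⟩ := exists_entry_ne (hinj C hC) (entry D (if a = b then p' else q'))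
        (i := 19) (j := 20) (by omega) (by omega) (by omega)
      obtain ⟨μ, h1, h2, h3, h4⟩ := exists_fSat_of_const_link₂ hrob
        [(entry C k, e), (entry C p, !a), (entry C q, a), (entry D p', !b), (entry D q', b)]
        (by simp [Consistent]; cases a <;> cases b <;> simp at hpx hqx ⊢ <;> grind)
        (by simp) hC hD hCD a b p q p' q' (by simp) (by simp)
        (by simp) (by simp) (by omega) (by omega) (by omega) (by omega) (by omega) (by omega)
      simp at h2
      grind

/-- The chain variables of `C` are given the common value `a`, the first two variables of `C`
are given distinct values, and one further variable is prescribed. -/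
theorem exists_fSat_const_first {J : Finset (Fin 21 → X)}
    (hinj : ∀ C ∈ J, Function.Injective C) (hrob : robust6 J) {C : Fin 21 → X} (hC : C ∈ J)
    {k j : ℕ} (hkj : k = 0 ∧ j = 1 ∨ k = 1 ∧ j = 0) (a b : Bool)
    {w : FVar X} (hw : inVar J w) (hx : w = Sum.inl (entry C k) → b = a)
    (hx' : w = Sum.inl (entry C j) → b = !a) (hz : ∀ i ≤ 17, w = link C i → b = a) :
    ∃ μ : FVar X → Bool, fSat J μ ∧ μ (Sum.inl (entry C k)) = a ∧
      μ (Sum.inl (entry C j)) = (!a) ∧ (∀ i ≤ 17, μ (link C i) = a) ∧ μ w = b := by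
  have hCi : ∀ i j, i ≤ 20 → j ≤ 20 → entry C i = entry C j → i = j :=
    fun i j hi hj => (entry_inj (hinj C hC) hi hj).1
  obtain ⟨x, rfl⟩ | ⟨D, hD, t, ht, rfl⟩ := inVar_cases hw
  · obtain ⟨q, hq, hqx⟩ := exists_entry_ne (hinj C hC) x (i := 19) (j := 20) (by omega)
      (by omega) (by omega)
    obtain ⟨μ, h1, h2, h3⟩ := exists_fSat_of_const_link hrob
      [(entry C k, a), (entry C j, !a), (entry C q, a), (x, b)]
      (by simp [Consistent]; cases a <;> cases b <;> grind) (by simp) hC a j q (by simp) (by simp) (by omega) (by omega)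
      (by omega)
    simp at h2
    grind
  · by_cases hCD : C = D
    · subst hCD
      obtain ⟨μ, h1, h2, h3⟩ := exists_fSat_of_const_link hrob
        [(entry C k, a), (entry C j, !a), (entry C 20, a)]
        (by simp [Consistent]; grind) (by simp) hC a j 20 (by simp) (by simp) (by omega)
        (by omega) (by omega)
      simp at h2
      grind
    · have hDi : ∀ i j, i ≤ 20 → j ≤ 20 → entry D i = entry D j → i = j :=
        fun i j hi hj => (entry_inj (hinj D hD) hi hj).1
      obtain ⟨p', hp', hpx'⟩ := exists_entry_ne (hinj D hD) (entry C (if a = b then k else j))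
        (i := 0) (j := 1) (by omega) (by omega) (by omega)
      obtain ⟨q', hq', hqx'⟩ := exists_entry_ne (hinj D hD) (entry C (if a = b then j else k))
        (i := 19) (j := 20) (by omega) (by omega) (by omega)
      obtain ⟨q, hq, hqx⟩ := exists_entry_ne (hinj C hC) (entry D (if a = b then p' else q'))
        (i := 19) (j := 20) (by omega) (by omega) (by omega)
      obtain ⟨μ, h1, h2, h3, h4⟩ := exists_fSat_of_const_link₂ hrob
        [(entry C k, a), (entry C j, !a), (entry C q, a), (entry D p', !b), (entry D q', b)]
        (by simp [Consistent]; cases a <;> cases b <;> simp at hpx' hqx' hqx ⊢ <;> grind)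
        (by simp) hC hD hCD a b j q p' q' (by simp) (by simp)
        (by simp) (by simp) (by omega) (by omega) (by omega) (by omega) (by omega) (by omega)
      simp at h2
      grind

/-- The chain variables of `C` are given the common value `a`, the last two variables of `C`
are given distinct values, and one further variable is prescribed. -/
theorem exists_fSat_const_last {J : Finset (Fin 21 → X)}
    (hinj : ∀ C ∈ J, Function.Injective C) (hrob : robust6 J) {C : Fin 21 → X} (hC : C ∈ J)
    {k j : ℕ} (hkj : k = 19 ∧ j = 20 ∨ k = 20 ∧ j = 19) (a b : Bool)
    {w : FVar X} (hw : inVar J w) (hx : w = Sum.inl (entry C k) → b = !a)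
    (hx' : w = Sum.inl (entry C j) → b = a) (hz : ∀ i ≤ 17, w = link C i → b = a) :
    ∃ μ : FVar X → Bool, fSat J μ ∧ μ (Sum.inl (entry C k)) = (!a) ∧
      μ (Sum.inl (entry C j)) = a ∧ (∀ i ≤ 17, μ (link C i) = a) ∧ μ w = b := by
  have hCi : ∀ i j, i ≤ 20 → j ≤ 20 → entry C i = entry C j → i = j :=
    fun i j hi hj => (entry_inj (hinj C hC) hi hj).1
  obtain ⟨x, rfl⟩ | ⟨D, hD, t, ht, rfl⟩ := inVar_cases hw
  · obtain ⟨p, hp, hpx⟩ := exists_entry_ne (hinj C hC) x (i := 0) (j := 1) (by omega)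
      (by omega) (by omega)
    obtain ⟨μ, h1, h2, h3⟩ := exists_fSat_of_const_link hrob
      [(entry C k, !a), (entry C j, a), (entry C p, !a), (x, b)]
      (by simp [Consistent]; cases a <;> cases b <;> grind) (by simp) hC a p j (by simp) (by simp) (by omega) (by omega)
      (by omega)
    simp at h2
    grind
  · by_cases hCD : C = D
    · subst hCD
      obtain ⟨μ, h1, h2, h3⟩ := exists_fSat_of_const_link hrob
        [(entry C k, !a), (entry C j, a), (entry C 0, !a)]
        (by simp [Consistent]; grind) (by simp) hC a 0 j (by simp) (by simp) (by omega)
        (by omega) (by omega)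
      simp at h2
      grind
    · have hDi : ∀ i j, i ≤ 20 → j ≤ 20 → entry D i = entry D j → i = j :=
        fun i j hi hj => (entry_inj (hinj D hD) hi hj).1
      obtain ⟨p', hp', hpx'⟩ := exists_entry_ne (hinj D hD) (entry C (if a = b then j else k))
        (i := 0) (j := 1) (by omega) (by omega) (by omega)
      obtain ⟨q', hq', hqx'⟩ := exists_entry_ne (hinj D hD) (entry C (if a = b then k else j))
        (i := 19) (j := 20) (by omega) (by omega) (by omega)
      obtain ⟨p, hp, hpx⟩ := exists_entry_ne (hinj C hC) (entry D (if a = b then q' else p'))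
        (i := 0) (j := 1) (by omega) (by omega) (by omega)
      obtain ⟨μ, h1, h2, h3, h4⟩ := exists_fSat_of_const_link₂ hrob
        [(entry C k, !a), (entry C j, a), (entry C p, !a), (entry D p', !b), (entry D q', b)]
        (by simp [Consistent]; cases a <;> cases b <;> simp at hpx' hqx' hpx ⊢ <;> grind)
        (by simp) hC hD hCD a b p j p' q' (by simp) (by simp)
        (by simp) (by simp) (by omega) (by omega) (by omega) (by omega) (by omega) (by omega)
      simp at h2
      grind

theorem exists_fSat_of_switch {J : Finset (Fin 21 → X)} (hrob : robust6 J)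
    (L : List (X × Bool)) (hL : Consistent L) (hlen : L.length ≤ 6)
    {C : Fin 21 → X} (hC : C ∈ J) (a : Bool) (p r q : ℕ)
    (hp : (entry C p, !a) ∈ L) (hq : (entry C q, !a) ∈ L) (hr : (entry C (r + 2), a) ∈ L)
    (hp1 : p ≤ 1) (hq19 : 19 ≤ q) (hq20 : q ≤ 20) (hr16 : r ≤ 16) :
    ∃ μ : FVar X → Bool, fSat J μ ∧ (∀ u ∈ L, μ (Sum.inl u.1) = u.2) ∧
      (∀ i ≤ r, μ (link C i) = a) ∧ ∀ i ≤ 17, r < i → μ (link C i) = !a := by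
  obtain ⟨μ, h, h', h1, h2⟩ := exists_fSat_of_link hrob L hL hlen hC a (!a) p r q hp hq
    (by omega) (by omega) hq20 (by omega) fun _ => ⟨by omega, hr⟩
  exact ⟨μ, h, h', fun i hi => h1 i (by omega) hi, fun i hi hi' => h2 i hi' (by omega) hi⟩

theorem exists_fSat_majority_first {J : Finset (Fin 21 → X)}
    (hinj : ∀ C ∈ J, Function.Injective C) (hrob : robust6 J) {C : Fin 21 → X} (hC : C ∈ J)
    {l : FLit X} {c : FCl X}
    (hc : c = ((Sum.inl (entry C 0), true), (Sum.inl (entry C 1), true), (link C 0, true)))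
    (hl : litIn l c) {w : FVar X} (hw : inVar J w) (a b : Bool) (hlw : l.1 = w → a = b) :
    ∃ μ : FVar X → Bool, fSat J μ ∧ μ l.1 = a ∧ μ w = b ∧ majorityIn μ l c := by
  have hCi : ∀ i j, i ≤ 20 → j ≤ 20 → entry C i = entry C j → i = j :=
    fun i j hi hj => (entry_inj (hinj C hC) hi hj).1
  have hentry : ∀ k j, (k = 0 ∧ j = 1 ∨ k = 1 ∧ j = 0) →
      (Sum.inl (entry C k) = w → a = b) → ∃ μ : FVar X → Bool, fSat J μ ∧
        μ (Sum.inl (entry C k)) = a ∧ μ w = b ∧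
        (μ (Sum.inl (entry C j)) = a ∨ μ (link C 0) = a) := by
    intro k j hkj hkw
    by_cases hj : w = Sum.inl (entry C j) ∧ b = a
    · obtain ⟨rfl, rfl⟩ := hj
      obtain ⟨μ, h1, h2⟩ := exists_fSat_of_consistent hrob [(entry C k, b), (entry C j, b)]
        (by simp [Consistent]) (by simp)
      simp at h2
      exact ⟨μ, h1, h2.1, h2.2, Or.inl h2.2⟩
    by_cases ht : ∃ t ≤ 17, w = link C t ∧ b = !a
    · obtain ⟨t, ht, rfl, rfl⟩ := ht
      obtain ⟨μ, h1, h2, h3⟩ := exists_fSat_of_const_link hrob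
        [(entry C k, a), (entry C j, a), (entry C 20, !a)]
        (by simp [Consistent]; grind) (by simp) hC (!a) k 20 (by simp) (by simp) (by omega)
        (by omega) (by omega)
      simp at h2
      exact ⟨μ, h1, h2.1, h3 t ht, Or.inl h2.2.1⟩
    · obtain ⟨μ, h1, h2, -, h4, h5⟩ := exists_fSat_const_first hinj hrob hC hkj a b hw
        (fun h => (hkw h.symm).symm) (fun h => by
          have : b ≠ a := fun h' => hj ⟨h, h'⟩
          exact Bool.eq_not.2 this)
        (fun i hi h => by
          by_contra h'
          exact ht ⟨i, hi, h, Bool.eq_not.2 h'⟩)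
      exact ⟨μ, h1, h2, h5, Or.inr (h4 0 (by omega))⟩
  subst hc
  obtain rfl | rfl | rfl := hl
  · obtain ⟨μ, h1, h2, h3, h4⟩ := hentry 0 1 (by simp) hlw
    exact ⟨μ, h1, h2, h3, by simp [majorityIn, litVal]; grind⟩
  · obtain ⟨μ, h1, h2, h3, h4⟩ := hentry 1 0 (by simp) hlw
    exact ⟨μ, h1, h2, h3, by simp [majorityIn, litVal]; grind⟩
  · by_cases ht : ∃ t ≤ 17, w = link C t ∧ b = !a
    · obtain ⟨t, ht, rfl, rfl⟩ := ht
      have ht0 : t ≠ 0 := by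
        rintro rfl
        simpa using hlw rfl
      obtain ⟨μ, h1, h2, h3, h4⟩ := exists_fSat_of_switch hrob
        [(entry C 0, !a), (entry C 1, a), (entry C 2, a), (entry C 20, !a)]
        (by simp [Consistent]; grind) (by simp) hC a 0 0 20 (by simp) (by simp) (by simp)
        (by omega) (by omega) (by omega) (by omega)
      simp at h2
      have h0 := h3 0 le_rfl
      exact ⟨μ, h1, h0, h4 t ht (by omega), by simp [majorityIn, litVal]; grind⟩
    · have hz : ∀ i ≤ 17, w = link C i → b = a := fun i hi h => by
        by_contra h'
        exact ht ⟨i, hi, h, Bool.eq_not.2 h'⟩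
      obtain ⟨k, j, hkj, hk, hj⟩ : ∃ k j, (k = 0 ∧ j = 1 ∨ k = 1 ∧ j = 0) ∧
          (w = Sum.inl (entry C k) → b = a) ∧ (w = Sum.inl (entry C j) → b = !a) := by
        have hne : entry C 0 ≠ entry C 1 := fun h => by simpa using hCi _ _ (by omega) (by omega) h
        by_cases h : w = Sum.inl (entry C 0) ∧ b = (!a) ∨ w = Sum.inl (entry C 1) ∧ b = a
        · exact ⟨1, 0, by simp, by cases a <;> cases b <;> grind,
            by cases a <;> cases b <;> grind⟩
        · exact ⟨0, 1, by simp, by cases a <;> cases b <;> grind,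
            by cases a <;> cases b <;> grind⟩
      obtain ⟨μ, h1, h2, h3, h4, h5⟩ := exists_fSat_const_first hinj hrob hC hkj a b hw hk hj hz
      have h0 := h4 0 (by omega)
      exact ⟨μ, h1, h0, h5, by simp [majorityIn, litVal]; grind⟩

theorem exists_fSat_majority_last {J : Finset (Fin 21 → X)}
    (hinj : ∀ C ∈ J, Function.Injective C) (hrob : robust6 J) {C : Fin 21 → X} (hC : C ∈ J)
    {l : FLit X} {c : FCl X}
    (hc : c = ((link C 17, false), (Sum.inl (entry C 19), true), (Sum.inl (entry C 20), true)))
    (hl : litIn l c) {w : FVar X} (hw : inVar J w) (a b : Bool) (hlw : l.1 = w → a = b) :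
    ∃ μ : FVar X → Bool, fSat J μ ∧ μ l.1 = a ∧ μ w = b ∧ majorityIn μ l c := by
  have hCi : ∀ i j, i ≤ 20 → j ≤ 20 → entry C i = entry C j → i = j :=
    fun i j hi hj => (entry_inj (hinj C hC) hi hj).1
  have hentry : ∀ k j, (k = 19 ∧ j = 20 ∨ k = 20 ∧ j = 19) →
      (Sum.inl (entry C k) = w → a = b) → ∃ μ : FVar X → Bool, fSat J μ ∧
        μ (Sum.inl (entry C k)) = a ∧ μ w = b ∧
        (μ (Sum.inl (entry C j)) = a ∨ μ (link C 17) = !a) := by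
    intro k j hkj hkw
    by_cases hj : w = Sum.inl (entry C j) ∧ b = a
    · obtain ⟨rfl, rfl⟩ := hj
      obtain ⟨μ, h1, h2⟩ := exists_fSat_of_consistent hrob [(entry C k, b), (entry C j, b)]
        (by simp [Consistent]) (by simp)
      simp at h2
      exact ⟨μ, h1, h2.1, h2.2, Or.inl h2.2⟩
    by_cases ht : ∃ t ≤ 17, w = link C t ∧ b = a
    · obtain ⟨t, ht, rfl, rfl⟩ := ht
      obtain ⟨μ, h1, h2, h3⟩ := exists_fSat_of_const_link hrob
        [(entry C k, b), (entry C j, b), (entry C 0, !b)]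
        (by simp [Consistent]; grind) (by simp) hC b 0 k (by simp) (by simp) (by omega)
        (by omega) (by omega)
      simp at h2
      exact ⟨μ, h1, h2.1, h3 t ht, Or.inl h2.2.1⟩
    · obtain ⟨μ, h1, h2, -, h4, h5⟩ := exists_fSat_const_last hinj hrob hC hkj (!a) b hw
        (fun h => by simpa using (hkw h.symm).symm) (fun h => by
          have : b ≠ a := fun h' => hj ⟨h, h'⟩
          exact Bool.eq_not.2 this)
        (fun i hi h => Bool.eq_not.2 fun h' => ht ⟨i, hi, h, h'⟩)
      exact ⟨μ, h1, by simpa using h2, h5, Or.inr (h4 17 le_rfl)⟩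
  subst hc
  obtain rfl | rfl | rfl := hl
  · by_cases ht : ∃ t ≤ 17, w = link C t ∧ b = !a
    · obtain ⟨t, ht, rfl, rfl⟩ := ht
      have ht0 : t ≠ 17 := by
        rintro rfl
        simpa using hlw rfl
      obtain ⟨μ, h1, h2, h3, h4⟩ := exists_fSat_of_switch hrob
        [(entry C 0, a), (entry C 18, !a), (entry C 19, a), (entry C 20, !a)]
        (by simp [Consistent]; grind) (by simp) hC (!a) 0 16 19 (by simp) (by simp) (by simp)
        (by omega) (by omega) (by omega) (by omega)
      simp at h2
      have h0 := h4 17 le_rfl (by omega)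
      exact ⟨μ, h1, by simpa using h0, h3 t (by omega), by simp [majorityIn, litVal]; grind⟩
    · have hz : ∀ i ≤ 17, w = link C i → b = a := fun i hi h => by
        by_contra h'
        exact ht ⟨i, hi, h, Bool.eq_not.2 h'⟩
      obtain ⟨k, j, hkj, hk, hj⟩ : ∃ k j, (k = 19 ∧ j = 20 ∨ k = 20 ∧ j = 19) ∧
          (w = Sum.inl (entry C k) → b = !a) ∧ (w = Sum.inl (entry C j) → b = a) := by
        have hne : entry C 19 ≠ entry C 20 := fun h => by simpa using hCi _ _ (by omega) (by omega) h
        by_cases h : w = Sum.inl (entry C 19) ∧ b = a ∨ w = Sum.inl (entry C 20) ∧ b = !a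
        · exact ⟨20, 19, by simp, by cases a <;> cases b <;> grind,
            by cases a <;> cases b <;> grind⟩
        · exact ⟨19, 20, by simp, by cases a <;> cases b <;> grind,
            by cases a <;> cases b <;> grind⟩
      obtain ⟨μ, h1, h2, h3, h4, h5⟩ := exists_fSat_const_last hinj hrob hC hkj a b hw hk hj hz
      have h0 := h4 17 le_rfl
      exact ⟨μ, h1, h0, h5, by simp [majorityIn, litVal]; grind⟩
  · obtain ⟨μ, h1, h2, h3, h4⟩ := hentry 19 20 (by simp) hlw
    exact ⟨μ, h1, h2, h3, by simp [majorityIn, litVal]; grind⟩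
  · obtain ⟨μ, h1, h2, h3, h4⟩ := hentry 20 19 (by simp) hlw
    exact ⟨μ, h1, h2, h3, by simp [majorityIn, litVal]; grind⟩

theorem exists_fSat_majority_middle {J : Finset (Fin 21 → X)}
    (hinj : ∀ C ∈ J, Function.Injective C) (hrob : robust6 J) {C : Fin 21 → X} (hC : C ∈ J)
    {s : ℕ} (hs : s < 17) {l : FLit X} {c : FCl X}
    (hc : c = ((link C s, false), (Sum.inl (entry C (s + 2)), true), (link C (s + 1), true)))
    (hl : litIn l c) {w : FVar X} (hw : inVar J w) (a b : Bool) (hlw : l.1 = w → a = b) :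
    ∃ μ : FVar X → Bool, fSat J μ ∧ μ l.1 = a ∧ μ w = b ∧ majorityIn μ l c := by
  have hCi : ∀ i j, i ≤ 20 → j ≤ 20 → entry C i = entry C j → i = j :=
    fun i j hi hj => (entry_inj (hinj C hC) hi hj).1
  subst hc
  obtain rfl | rfl | rfl := hl
  · by_cases hx : w = Sum.inl (entry C (s + 2)) ∧ b = a ∨ ∃ t ≤ 17, s < t ∧ w = link C t ∧ b = !a
    · obtain ⟨μ, h1, h2, h3, h4⟩ := exists_fSat_of_switch hrob
        [(entry C 0, !a), (entry C (s + 2), a), (entry C 20, !a)]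
        (by simp [Consistent]; grind) (by simp) hC a 0 s 20 (by simp) (by simp) (by simp)
        (by omega) (by omega) (by omega) (by omega)
      simp at h2
      have h0 := h3 s le_rfl
      have h0' := h4 (s + 1) (by omega) (by omega)
      exact ⟨μ, h1, h0, by grind, by simp [majorityIn, litVal]; grind⟩
    by_cases ht : ∃ t < s, w = link C t ∧ b = !a
    · obtain ⟨t, ht, rfl, rfl⟩ := ht
      obtain ⟨s, rfl⟩ : ∃ r, s = r + 1 := ⟨s - 1, by omega⟩
      obtain ⟨μ, h1, h2, h3, h4⟩ := exists_fSat_of_switch hrob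
        [(entry C 0, a), (entry C (s + 2), !a), (entry C (s + 3), !a), (entry C 20, a)]
        (by simp [Consistent]; grind) (by simp) hC (!a) 0 s 20 (by simp) (by simp) (by simp)
        (by omega) (by omega) (by omega) (by omega)
      simp at h2
      have h0 := h4 (s + 1) (by omega) (by omega)
      exact ⟨μ, h1, by simpa using h0, h3 t (by omega), by simp [majorityIn, litVal]; grind⟩
    · obtain ⟨μ, h1, h2, h3, h4⟩ := exists_fSat_const_middle hinj hrob hC (k := s + 2) (by omega)
        (by omega) (!a) a b hw (by cases a <;> cases b <;> grind)
        (fun i hi h => by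
          obtain h' | h' | h' := lt_trichotomy i s
          · cases a <;> cases b <;> grind
          · subst h'; exact (hlw h.symm).symm
          · cases a <;> cases b <;> grind)
      have h0 := h3 s (by omega)
      exact ⟨μ, h1, h0, h4, by simp [majorityIn, litVal]; grind⟩
  · obtain ⟨e, he⟩ : ∃ e, ∀ i ≤ 17, w = link C i → b = e := ⟨b, by simp⟩
    obtain ⟨μ, h1, h2, h3, h4⟩ := exists_fSat_const_middle hinj hrob hC (k := s + 2) (by omega)
      (by omega) a e b hw (fun h => (hlw h.symm).symm) he
    have h0 := h3 s (by omega)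
    have h0' := h3 (s + 1) (by omega)
    exact ⟨μ, h1, h2, h4, by simp [majorityIn, litVal]; cases a <;> cases e <;> simp_all⟩
  · by_cases hx : w = Sum.inl (entry C (s + 2)) ∧ b = (!a) ∨ ∃ t ≤ s, w = link C t ∧ b = !a
    · obtain ⟨μ, h1, h2, h3, h4⟩ := exists_fSat_of_switch hrob
        [(entry C 0, a), (entry C (s + 2), !a), (entry C 20, a)]
        (by simp [Consistent]; grind) (by simp) hC (!a) 0 s 20 (by simp) (by simp) (by simp)
        (by omega) (by omega) (by omega) (by omega)
      simp at h2
      have h0 := h3 s le_rfl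
      have h0' := h4 (s + 1) (by omega) (by omega)
      exact ⟨μ, h1, by simpa using h0', by grind, by simp [majorityIn, litVal]; grind⟩
    by_cases ht : ∃ t ≤ 17, s + 1 < t ∧ w = link C t ∧ b = !a
    · obtain ⟨t, ht, hst, rfl, rfl⟩ := ht
      obtain ⟨μ, h1, h2, h3, h4⟩ := exists_fSat_of_switch hrob
        [(entry C 0, !a), (entry C (s + 2), a), (entry C (s + 3), a), (entry C 20, !a)]
        (by simp [Consistent]; grind) (by simp) hC a 0 (s + 1) 20 (by simp) (by simp) (by simp)
        (by omega) (by omega) (by omega) (by omega)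
      simp at h2
      have h0 := h3 (s + 1) le_rfl
      exact ⟨μ, h1, h0, h4 t ht hst, by simp [majorityIn, litVal]; grind⟩
    · obtain ⟨μ, h1, h2, h3, h4⟩ := exists_fSat_const_middle hinj hrob hC (k := s + 2) (by omega)
        (by omega) a a b hw (by cases a <;> cases b <;> grind)
        (fun i hi h => by
          obtain h' | h' | h' := lt_trichotomy i (s + 1)
          · cases a <;> cases b <;> grind
          · subst h'; exact (hlw h.symm).symm
          · cases a <;> cases b <;> grind)
      have h0 := h3 (s + 1) (by omega)
      exact ⟨μ, h1, h0, h4, by simp [majorityIn, litVal]; grind⟩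

/-- A literal of a clause can be given a majority value together with any consistent value of
one further variable. -/
theorem exists_fSat_majority {J : Finset (Fin 21 → X)}
    (hinj : ∀ C ∈ J, Function.Injective C) (hrob : robust6 J) {l : FLit X} {c : FCl X}
    (hc : c ∈ fClauses J) (hl : litIn l c) {w : FVar X} (hw : inVar J w) (a b : Bool)
    (hlw : l.1 = w → a = b) :
    ∃ μ : FVar X → Bool, fSat J μ ∧ μ l.1 = a ∧ μ w = b ∧ majorityIn μ l c := by
  obtain ⟨C, hC, hc | ⟨s, hs, hc⟩ | hc⟩ := (mem_fClauses_iff J c).1 hc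
  · exact exists_fSat_majority_first hinj hrob hC hc hl hw a b hlw
  · exact exists_fSat_majority_middle hinj hrob hC hs hc hl hw a b hlw
  · exact exists_fSat_majority_last hinj hrob hC hc hl hw a b hlw

theorem inVar_of_litIn {J : Finset (Fin 21 → X)} {c : FCl X} (hc : c ∈ fClauses J) {l : FLit X}
    (hl : litIn l c) : inVar J l.1 := by
  obtain ⟨C, hC, rfl | ⟨s, hs, rfl⟩ | rfl⟩ := (mem_fClauses_iff J c).1 hc <;>
    obtain rfl | rfl | rfl := hl <;> trivial

theorem exists_litIn {J : Finset (Fin 21 → X)} {C : Fin 21 → X} (hC : C ∈ J) {t : ℕ}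
    (ht : t ≤ 17) : ∃ c ∈ fClauses J, ∃ e, litIn (link C t, e) c := by
  obtain ht | rfl := ht.lt_or_eq
  · exact ⟨_, (mem_fClauses_iff J _).2 ⟨C, hC, Or.inr (Or.inl ⟨t, ht, rfl⟩)⟩, false, Or.inl rfl⟩
  · exact ⟨_, (mem_fClauses_iff J _).2 ⟨C, hC, Or.inr (Or.inr rfl)⟩, false, Or.inl rfl⟩

theorem exists_fSat_of_pair {J : Finset (Fin 21 → X)} (hinj : ∀ C ∈ J, Function.Injective C)
    (hrob : robust6 J) {v w : FVar X} (hv : inVar J v) (hw : inVar J w) (a b : Bool)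
    (hvw : v = w → a = b) : ∃ μ : FVar X → Bool, fSat J μ ∧ μ v = a ∧ μ w = b := by
  obtain ⟨x, rfl⟩ | ⟨C, hC, t, ht, rfl⟩ := inVar_cases hv
  · obtain ⟨y, rfl⟩ | ⟨C, hC, t, ht, rfl⟩ := inVar_cases hw
    · obtain ⟨μ, h1, h2⟩ := exists_fSat_of_consistent hrob [(x, a), (y, b)]
        (by simpa [Consistent] using hvw) (by simp)
      simp at h2
      exact ⟨μ, h1, h2⟩
    · obtain ⟨c, hc, e, hl⟩ := exists_litIn hC ht
      obtain ⟨μ, h1, h2, h3, -⟩ := exists_fSat_majority hinj hrob hc hl hv b a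
        fun h => (hvw h.symm).symm
      exact ⟨μ, h1, h3, h2⟩
  · obtain ⟨c, hc, e, hl⟩ := exists_litIn hC ht
    obtain ⟨μ, h1, h2, h3, -⟩ := exists_fSat_majority hinj hrob hc hl hw a b hvw
    exact ⟨μ, h1, h2, h3⟩

theorem varIn_of_litIn_pos {J : Finset (Fin 21 → X)} {c : FCl X} (hc : c ∈ fClauses J)
    {C : Fin 21 → X} {t : ℕ} (ht : t ≤ 17) (h : litIn (link C t, true) c) :
    varIn (Sum.inl (entry C (t + 1))) c := by
  obtain ⟨D, hD, rfl | ⟨s, hs, rfl⟩ | rfl⟩ := (mem_fClauses_iff J c).1 hc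
  · obtain h | h | h := h
    · exact absurd (congrArg Prod.fst h).symm (inl_ne_link _ _ _)
    · exact absurd (congrArg Prod.fst h).symm (inl_ne_link _ _ _)
    · obtain ⟨rfl, rfl⟩ := (link_inj ht (by omega)).1 (congrArg Prod.fst h)
      exact Or.inr (Or.inl rfl)
  · obtain h | h | h := h
    · exact absurd (congrArg Prod.snd h) (by simp)
    · exact absurd (congrArg Prod.fst h).symm (inl_ne_link _ _ _)
    · obtain ⟨rfl, rfl⟩ := (link_inj ht (by omega)).1 (congrArg Prod.fst h)
      exact Or.inr (Or.inl rfl)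
  · obtain h | h | h := h
    · exact absurd (congrArg Prod.snd h) (by simp)
    · exact absurd (congrArg Prod.fst h).symm (inl_ne_link _ _ _)
    · exact absurd (congrArg Prod.fst h).symm (inl_ne_link _ _ _)

theorem varIn_of_litIn_neg {J : Finset (Fin 21 → X)} {c : FCl X} (hc : c ∈ fClauses J)
    {C : Fin 21 → X} {t : ℕ} (ht : t ≤ 17) (h : litIn (link C t, false) c) :
    varIn (Sum.inl (entry C (t + 2))) c := by
  obtain ⟨D, hD, rfl | ⟨s, hs, rfl⟩ | rfl⟩ := (mem_fClauses_iff J c).1 hc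
  · obtain h | h | h := h <;> exact absurd (congrArg Prod.snd h) (by simp)
  · obtain h | h | h := h
    · obtain ⟨rfl, rfl⟩ := (link_inj ht (by omega)).1 (congrArg Prod.fst h)
      exact Or.inr (Or.inl rfl)
    · exact absurd (congrArg Prod.snd h) (by simp)
    · exact absurd (congrArg Prod.snd h) (by simp)
  · obtain h | h | h := h
    · obtain ⟨rfl, rfl⟩ := (link_inj ht (by omega)).1 (congrArg Prod.fst h)
      exact Or.inr (Or.inl rfl)
    · exact absurd (congrArg Prod.snd h) (by simp)
    · exact absurd (congrArg Prod.snd h) (by simp)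

/-- Any not-all-equal assignment of the literals of a single clause extends. -/
theorem exists_fSat_of_clause {J : Finset (Fin 21 → X)} (hinj : ∀ C ∈ J, Function.Injective C)
    (hrob : robust6 J) {c : FCl X} (hc : c ∈ fClauses J) (b₁ b₂ b₃ : Bool)
    (hb : ¬(b₁ = b₂ ∧ b₂ = b₃)) :
    ∃ μ : FVar X → Bool,
      fSat J μ ∧ litVal μ c.1 = b₁ ∧ litVal μ c.2.1 = b₂ ∧ litVal μ c.2.2 = b₃ := by
  obtain ⟨C, hC, hcC⟩ := (mem_fClauses_iff J c).1 hc
  have hCi : ∀ i j, i ≤ 20 → j ≤ 20 → entry C i = entry C j → i = j :=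
    fun i j hi hj => (entry_inj (hinj C hC) hi hj).1
  obtain rfl | ⟨s, hs, rfl⟩ | rfl := hcC
  · obtain ⟨μ, h1, h2, h3⟩ := exists_fSat_of_const_link hrob
      [(entry C 0, b₁), (entry C 1, b₂), (entry C 20, b₃)] (by simp [Consistent]; grind) (by simp)
      hC b₃ (if b₁ = b₃ then 1 else 0) 20 (by cases b₁ <;> cases b₂ <;> cases b₃ <;> simp_all)
      (by simp) (by split_ifs <;> omega) (by omega) (by omega)
    simp at h2
    exact ⟨μ, h1, by simpa [litVal] using ⟨h2.1, h2.2.1, h3 0 (by omega)⟩⟩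
  · by_cases h : b₃ = !b₁
    · obtain ⟨μ, h1, h2, h3⟩ := exists_fSat_of_const_link hrob
        [(entry C 0, !b₃), (entry C (s + 2), b₂), (entry C 20, b₃)]
        (by simp [Consistent]; grind) (by simp) hC b₃ 0 20 (by simp) (by simp) (by omega)
        (by omega) (by omega)
      simp at h2
      have h4 := h3 s (by omega)
      have h5 := h3 (s + 1) (by omega)
      exact ⟨μ, h1, by simp [litVal, h2, h4, h5, h]⟩
    · obtain ⟨rfl, rfl⟩ : b₁ = b₃ ∧ b₂ = !b₃ := by
        cases b₁ <;> cases b₂ <;> cases b₃ <;> simp_all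
      obtain ⟨μ, h1, h2, h3, h4⟩ := exists_fSat_of_switch hrob
        [(entry C 0, b₁), (entry C (s + 2), !b₁), (entry C 20, b₁)]
        (by simp [Consistent]; grind) (by simp) hC (!b₁) 0 s 20 (by simp) (by simp) (by simp)
        (by omega) (by omega) (by omega) (by omega)
      simp at h2
      have h5 := h3 s le_rfl
      have h6 := h4 (s + 1) (by omega) (by omega)
      exact ⟨μ, h1, by simp [litVal, h2, h5, h6]⟩
  · obtain ⟨μ, h1, h2, h3⟩ := exists_fSat_of_const_link hrob
      [(entry C 0, b₁), (entry C 19, b₂), (entry C 20, b₃)] (by simp [Consistent]; grind) (by simp)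
      hC (!b₁) 0 (if b₁ = b₂ then 20 else 19) (by simp)
      (by cases b₁ <;> cases b₂ <;> cases b₃ <;> simp_all)
      (by omega) (by split_ifs <;> omega) (by split_ifs <;> omega)
    simp at h2
    exact ⟨μ, h1, by simpa [litVal] using ⟨by simp [h3 17 le_rfl], h2.2⟩⟩

theorem litVal_eq_iff (μ : FVar X → Bool) (l : FLit X) (b : Bool) :
    litVal μ l = b ↔ μ l.1 = if l.2 then b else !b := by
  rcases l with ⟨v, _ | _⟩ <;> simp [litVal, Bool.not_eq_eq_eq_not]

end NaeChain

/-- If a monotone NAE21SAT instance `J` (clauses are strictly increasing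
21-tuples) is 6-robustly NAE-satisfiable, then the chain-reduced NAE3SAT instance `f(J)`
is (1) 2-robustly NAE-satisfiable; (2) any consistent assignment of values to two literals
of distinct clauses `c`, `d` extends to a NAE-satisfying assignment making the first
literal take a majority value in `c`; (3) a `Z`-variable occurring positively in `c` and
negatively in `d` can be matched in value by `X`-variables of `c` and `d` respectively
under some NAE-satisfying assignment; (4) any not-all-equal assignment of values to the
three literals of a single clause extends to a NAE-satisfying assignment. -/
theorem stmt_9 {X : Type} [LinearOrder X] [Fintype X]
    (J : Finset (Fin 21 → X)) (hmono : ∀ C ∈ J, StrictMono C)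
    (hrob : robust6 J) :
    -- (1)
    (∀ v w : FVar X, inVar J v → inVar J w → ∀ bv bw : Bool, (v = w → bv = bw) →
      ∃ μ : FVar X → Bool, fSat J μ ∧ μ v = bv ∧ μ w = bw) ∧
    -- (2)
    (∀ c ∈ fClauses J, ∀ d ∈ fClauses J, c ≠ d →
      ∀ l l' : FLit X, litIn l c → litIn l' d → ∀ bv bw : Bool,
        (l = l' → bv = bw) → (l.1 = l'.1 → l.2 ≠ l'.2 → bv = !bw) →
        ∃ μ : FVar X → Bool,
          fSat J μ ∧ litVal μ l = bv ∧ litVal μ l' = bw ∧ majorityIn μ l c) ∧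
    -- (3)
    (∀ z : FVar X, (∃ C ∈ J, ∃ t : Fin 18, z = Sum.inr (C, t)) →
      ∀ c ∈ fClauses J, ∀ d ∈ fClauses J,
        litIn (z, true) c → litIn (z, false) d →
        ∃ x y : X, varIn (Sum.inl x) c ∧ varIn (Sum.inl y) d ∧
          ∃ μ : FVar X → Bool,
            fSat J μ ∧ μ (Sum.inl x) = μ z ∧ μ (Sum.inl y) = !(μ z)) ∧
    -- (4)
    (∀ c ∈ fClauses J, ∀ b₁ b₂ b₃ : Bool, ¬(b₁ = b₂ ∧ b₂ = b₃) →
      ∃ μ : FVar X → Bool,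
        fSat J μ ∧ litVal μ c.1 = b₁ ∧ litVal μ c.2.1 = b₂ ∧ litVal μ c.2.2 = b₃) := by
  have hinj : ∀ C ∈ J, Function.Injective C := fun C hC => (hmono C hC).injective
  refine ⟨fun v w hv hw bv bw hvw => NaeChain.exists_fSat_of_pair hinj hrob hv hw bv bw hvw,
    ?_, ?_, fun c hc b₁ b₂ b₃ hb => NaeChain.exists_fSat_of_clause hinj hrob hc b₁ b₂ b₃ hb⟩
  · intro c hc d hd _ l l' hl hl' bv bw hsame hopp
    simp only [NaeChain.litVal_eq_iff]
    refine NaeChain.exists_fSat_majority hinj hrob hc hl (NaeChain.inVar_of_litIn hd hl') _ _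
      fun h => ?_
    obtain ⟨v, e⟩ := l
    obtain ⟨v', e'⟩ := l'
    obtain rfl : v = v' := h
    cases e <;> cases e' <;> simp_all
  · rintro z ⟨C, hC, t, rfl⟩ c hc d hd hlc hld
    have ht : (t : ℕ) ≤ 17 := by omega
    have htC : (Sum.inr (C, t) : FVar X) = NaeChain.link C t := by simp [NaeChain.link]
    rw [htC] at hlc hld ⊢
    have hCi : ∀ i j, i ≤ 20 → j ≤ 20 → NaeChain.entry C i = NaeChain.entry C j → i = j :=
      fun i j hi hj => (NaeChain.entry_inj (hinj C hC) hi hj).1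
    obtain ⟨μ, h1, h2, h3⟩ := NaeChain.exists_fSat_of_const_link hrob
      [(NaeChain.entry C 0, false), (NaeChain.entry C (t + 1), true),
        (NaeChain.entry C (t + 2), false), (NaeChain.entry C 20, true)]
      (by simp [NaeChain.Consistent]; grind) (by simp) hC true 0 20 (by simp) (by simp)
      (by omega) (by omega) (by omega)
    simp at h2
    exact ⟨_, _, NaeChain.varIn_of_litIn_pos hc ht hlc, NaeChain.varIn_of_litIn_neg hd ht hld,
      μ, h1, by rw [h3 t ht]; exact h2.2.1, by rw [h3 t ht]; exact h2.2.2.1⟩
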